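/- Let A, M ∈ ℝ^{n×n} be symmetric positive definite, C ∈ ℝ^{n×n} symmetric, and Y ∈ ℝ^{n×p} of full column rank. Set P = Y (YᵀY)⁻¹ Yᵀ, R = A Y Yᵀ M + M Y Yᵀ A − C, and 𝓡 = ‖R‖_F, and suppose R Y = 0 (the critical-point condition). Then for every horizontal vector ξ = Y S + Z (with Sᵀ = S and YᵀZ = 0), letting F = Y ξᵀ + ξ Yᵀ, one has (I − P) R (I − P) = R and tr(F (AFM + MFA)) + 2 tr(ξᵀ (I − P) R (I − P) ξ) ≥ (4 λ_min(YᵀY) λ_min(A) λ_min(M) − 2 𝓡) · tr(ξᵀ ξ). In particular, if 2 λ_min(YᵀY) λ_min(A) λ_min(M) > 𝓡, the Hessian quadratic form is strictly positive for every such nonzero ξ. -/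

import Mathlib

open Matrix

namespace Matrix

variable {m k : Type*} [Fintype m] [Fintype k]

lemma trace_transpose_mul_self_nonneg (B : Matrix m k ℝ) : 0 ≤ (Bᵀ * B).trace := by
  simpa using (posSemidef_conjTranspose_mul_self B).trace_nonneg

/-- A Hermitian matrix dominates its smallest eigenvalue times the identity. -/
lemma IsHermitian.posSemidef_sub_iInf_eigenvalues [DecidableEq m] {G : Matrix m m ℝ}
    (hG : G.IsHermitian) : (G - (⨅ i, hG.eigenvalues i) • (1 : Matrix m m ℝ)).PosSemidef := by
  have hdiag : (diagonal fun i => hG.eigenvalues i - ⨅ j, hG.eigenvalues j).PosSemidef :=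
    PosSemidef.diagonal fun i => sub_nonneg.2 (ciInf_le (Set.finite_range _).bddBelow i)
  have h := hdiag.mul_mul_conjTranspose_same (hG.eigenvectorUnitary : Matrix m m ℝ)
  convert h using 1
  have hU : (hG.eigenvectorUnitary : Matrix m m ℝ) * (hG.eigenvectorUnitary : Matrix m m ℝ)ᴴ = 1 :=
    Unitary.coe_mul_star_self hG.eigenvectorUnitary
  have hspec := hG.spectral_theorem
  rw [Unitary.conjStarAlgAut_apply] at hspec
  have hsub : (diagonal fun i => hG.eigenvalues i - ⨅ j, hG.eigenvalues j) =
      diagonal hG.eigenvalues - (⨅ j, hG.eigenvalues j) • (1 : Matrix m m ℝ) := by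
    rw [smul_one_eq_diagonal, diagonal_sub]
  rw [hsub, mul_sub, sub_mul, mul_smul_comm, smul_mul_assoc, mul_one, hU]
  congr 1

lemma IsHermitian.iInf_eigenvalues_mul_trace_le [DecidableEq m] {G : Matrix m m ℝ}
    (hG : G.IsHermitian) (B : Matrix m k ℝ) :
    (⨅ i, hG.eigenvalues i) * (Bᵀ * B).trace ≤ (Bᵀ * G * B).trace := by
  have h := (hG.posSemidef_sub_iInf_eigenvalues.conjTranspose_mul_mul_same B).trace_nonneg
  rw [conjTranspose_eq_transpose_of_trivial, Matrix.mul_sub, Matrix.sub_mul,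
    Matrix.mul_smul, Matrix.mul_one, Matrix.smul_mul, trace_sub, trace_smul, smul_eq_mul] at h
  linarith

open scoped MatrixOrder Matrix.Norms.L2Operator in
lemma PosDef.iInf_eigenvalues_mul_iInf_eigenvalues_mul_trace_le [DecidableEq m]
    {A M F : Matrix m m ℝ} (hA : A.PosDef) (hM : M.PosDef) (hF : F.IsSymm) :
    (⨅ i, hA.1.eigenvalues i) * (⨅ i, hM.1.eigenvalues i) * (F * F).trace ≤
      (F * A * F * M).trace := by
  obtain ⟨B, hB⟩ := CStarAlgebra.nonneg_iff_eq_star_mul_self.1 hA.posSemidef.nonneg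
  rw [star_eq_conjTranspose, conjTranspose_eq_transpose_of_trivial] at hB
  have h₁ := hA.1.iInf_eigenvalues_mul_trace_le F
  have h₂ := hM.1.iInf_eigenvalues_mul_trace_le (B * F)ᵀ
  have h₃ : ((B * F)ᵀᵀ * (B * F)ᵀ).trace = (Fᵀ * A * F).trace := by
    rw [transpose_transpose, trace_mul_comm, transpose_mul, hB]
    simp only [Matrix.mul_assoc]
  have h₄ : ((B * F)ᵀᵀ * M * (B * F)ᵀ).trace = (F * A * F * M).trace := by
    rw [transpose_transpose, trace_mul_comm, transpose_mul, hB, hF.eq]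
    simp only [Matrix.mul_assoc]
  have h₀ : 0 ≤ ⨅ i, hM.1.eigenvalues i := Real.iInf_nonneg fun i => (hM.eigenvalues_pos i).le
  rw [h₃, h₄] at h₂
  rw [hF.eq] at h₁ h₂
  calc _ = (⨅ i, hM.1.eigenvalues i) * ((⨅ i, hA.1.eigenvalues i) * (F * F).trace) := by ring
    _ ≤ _ := (mul_le_mul_of_nonneg_left h₁ h₀).trans h₂

open scoped Matrix.Norms.Frobenius in
lemma frobenius_norm_eq_sqrt_trace (B : Matrix m k ℝ) : ‖B‖ = √((Bᵀ * B).trace) := by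
  rw [frobenius_norm_def, ← Real.sqrt_eq_rpow, Finset.sum_comm]
  simp [trace, mul_apply, pow_two]

lemma trace_transpose_mul_sq_le (B D : Matrix m k ℝ) :
    (Bᵀ * D).trace ^ 2 ≤ (Bᵀ * B).trace * (Dᵀ * D).trace := by
  simp only [trace, diag_apply, mul_apply, transpose_apply, ← Fintype.sum_prod_type', ← pow_two]
  exact Finset.sum_mul_sq_le_sq_mul_sq _ _ _

open scoped Matrix.Norms.Frobenius in
lemma abs_trace_transpose_mul_mul_le (R : Matrix m m ℝ) (B : Matrix m k ℝ) :
    |(Bᵀ * R * B).trace| ≤ √((Rᵀ * R).trace) * (Bᵀ * B).trace := by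
  have h₁ : |(Bᵀ * R * B).trace| ≤ ‖B‖ * ‖R * B‖ := by
    rw [Matrix.mul_assoc, frobenius_norm_eq_sqrt_trace B, frobenius_norm_eq_sqrt_trace (R * B),
      ← Real.sqrt_mul (trace_transpose_mul_self_nonneg B)]
    exact Real.abs_le_sqrt (trace_transpose_mul_sq_le B (R * B))
  calc _ ≤ ‖B‖ * (‖R‖ * ‖B‖) :=
        h₁.trans (mul_le_mul_of_nonneg_left (frobenius_norm_mul R B) (norm_nonneg B))
    _ = ‖R‖ * (‖B‖ * ‖B‖) := by ring
    _ = _ := by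
      rw [frobenius_norm_eq_sqrt_trace R, frobenius_norm_eq_sqrt_trace B,
        Real.mul_self_sqrt (trace_transpose_mul_self_nonneg B)]

/-- On horizontal vectors, the linearisation of `Y ↦ Y Yᵀ` is bounded below by
`√(2 λ_min(YᵀY))` in the Frobenius norm. -/
lemma two_mul_iInf_eigenvalues_mul_trace_le_of_horizontal [DecidableEq k] {Y ξ Z : Matrix m k ℝ}
    {S : Matrix k k ℝ} (hYY : (Yᵀ * Y).IsHermitian) (hS : S.IsSymm) (hZ : Yᵀ * Z = 0)
    (hξ : ξ = Y * S + Z) :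
    2 * (⨅ i, hYY.eigenvalues i) * (ξᵀ * ξ).trace ≤
      ((Y * ξᵀ + ξ * Yᵀ) * (Y * ξᵀ + ξ * Yᵀ)).trace := by
  have hYξ : Yᵀ * ξ = Yᵀ * Y * S := by rw [hξ, Matrix.mul_add, hZ, add_zero, Matrix.mul_assoc]
  have hξY : ξᵀ * Y = S * (Yᵀ * Y) := by
    simpa [hS.eq, Matrix.mul_assoc] using congrArg transpose hYξ
  have h₁ : 0 ≤ (Y * ξᵀ * (Y * ξᵀ)).trace := by
    have h := trace_transpose_mul_self_nonneg (Y * S * Yᵀ)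
    convert h using 1
    calc (Y * ξᵀ * (Y * ξᵀ)).trace = (ξᵀ * Y * (ξᵀ * Y)).trace := by
          rw [Matrix.mul_assoc, trace_mul_comm]; simp only [Matrix.mul_assoc]
      _ = (Y * (S * (Yᵀ * Y) * S * Yᵀ)).trace := by
          rw [hξY, trace_mul_comm Y]; simp only [Matrix.mul_assoc]
      _ = _ := by simp only [transpose_mul, transpose_transpose, hS.eq, Matrix.mul_assoc]
  have h₂ : (ξ * Yᵀ * (ξ * Yᵀ)).trace = (Y * ξᵀ * (Y * ξᵀ)).trace := by
    rw [← trace_transpose (ξ * Yᵀ * (ξ * Yᵀ))]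
    simp only [transpose_mul, transpose_transpose]
  have h₃ : (⨅ i, hYY.eigenvalues i) * (ξᵀ * ξ).trace ≤ (ξ * Yᵀ * (Y * ξᵀ)).trace := by
    have h := hYY.iInf_eigenvalues_mul_trace_le ξᵀ
    rw [transpose_transpose, trace_mul_comm] at h
    simpa only [Matrix.mul_assoc] using h
  have h₄ := trace_mul_comm (Y * ξᵀ) (ξ * Yᵀ)
  simp only [mul_add, add_mul, trace_add]
  linarith

end Matrix

/-- At a critical point (`R Y = 0`), one has `(I − P) R (I − P) = R` and the
Riemannian Hessian quadratic form satisfies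
`tr(F (AFM + MFA)) + 2 tr(ξᵀ (I − P) R (I − P) ξ)
  ≥ (4 λ_min(YᵀY) λ_min(A) λ_min(M) − 2 𝓡) tr(ξᵀ ξ)`
for every horizontal `ξ = Y S + Z`, with `F = Y ξᵀ + ξ Yᵀ`. In particular, if
`2 λ_min(YᵀY) λ_min(A) λ_min(M) > 𝓡`, the Hessian quadratic form is strictly
positive for every such nonzero `ξ`. -/
theorem riemannian_hessian_posdef_at_critical_point
    {n p : ℕ} (A M C : Matrix (Fin n) (Fin n) ℝ)
    (hA : A.PosDef) (hM : M.PosDef) (hC : C.IsSymm)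
    (Y : Matrix (Fin n) (Fin p) ℝ) (hY : Y.rank = p)
    (hYY : (Yᵀ * Y).IsHermitian)
    (P : Matrix (Fin n) (Fin n) ℝ) (hP : P = Y * (Yᵀ * Y)⁻¹ * Yᵀ)
    (R : Matrix (Fin n) (Fin n) ℝ) (hR : R = A * Y * Yᵀ * M + M * Y * Yᵀ * A - C)
    (𝓡 : ℝ) (h𝓡 : 𝓡 = Real.sqrt ((Rᵀ * R).trace))
    (hcrit : R * Y = 0) :
    (1 - P) * R * (1 - P) = R ∧
    (∀ (S : Matrix (Fin p) (Fin p) ℝ) (Z ξ : Matrix (Fin n) (Fin p) ℝ),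
      S.IsSymm → Yᵀ * Z = 0 → ξ = Y * S + Z →
      ((Y * ξᵀ + ξ * Yᵀ) *
          (A * (Y * ξᵀ + ξ * Yᵀ) * M + M * (Y * ξᵀ + ξ * Yᵀ) * A)).trace
        + 2 * (ξᵀ * (1 - P) * R * (1 - P) * ξ).trace ≥
      (4 * (⨅ i, hYY.eigenvalues i) * (⨅ i, hA.1.eigenvalues i) *
          (⨅ i, hM.1.eigenvalues i) - 2 * 𝓡) * (ξᵀ * ξ).trace) ∧
    (2 * (⨅ i, hYY.eigenvalues i) * (⨅ i, hA.1.eigenvalues i) *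
        (⨅ i, hM.1.eigenvalues i) > 𝓡 →
      ∀ (S : Matrix (Fin p) (Fin p) ℝ) (Z ξ : Matrix (Fin n) (Fin p) ℝ),
        S.IsSymm → Yᵀ * Z = 0 → ξ = Y * S + Z → ξ ≠ 0 →
        0 < ((Y * ξᵀ + ξ * Yᵀ) *
              (A * (Y * ξᵀ + ξ * Yᵀ) * M + M * (Y * ξᵀ + ξ * Yᵀ) * A)).trace
          + 2 * (ξᵀ * (1 - P) * R * (1 - P) * ξ).trace) := by
  have hAt : Aᵀ = A := by simpa using hA.1.eq
  have hMt : Mᵀ = M := by simpa using hM.1.eq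
  have hRt : Rᵀ = R := by
    rw [hR]
    simp only [transpose_sub, transpose_add, transpose_mul, transpose_transpose, hAt, hMt, hC.eq,
      Matrix.mul_assoc]
    rw [add_comm]
  have hYR : Yᵀ * R = 0 := by simpa [hRt] using congrArg transpose hcrit
  have hproj : (1 - P) * R * (1 - P) = R := by
    have hPR : P * R = 0 := by rw [hP, Matrix.mul_assoc, hYR, Matrix.mul_zero]
    have hRP : R * P = 0 := by
      rw [hP, Matrix.mul_assoc Y, ← Matrix.mul_assoc R, hcrit, Matrix.zero_mul]
    rw [sub_mul, one_mul, hPR, sub_zero, mul_sub, mul_one, hRP, sub_zero]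
  have hbound : ∀ (S : Matrix (Fin p) (Fin p) ℝ) (Z ξ : Matrix (Fin n) (Fin p) ℝ),
      S.IsSymm → Yᵀ * Z = 0 → ξ = Y * S + Z →
      ((Y * ξᵀ + ξ * Yᵀ) *
          (A * (Y * ξᵀ + ξ * Yᵀ) * M + M * (Y * ξᵀ + ξ * Yᵀ) * A)).trace
        + 2 * (ξᵀ * (1 - P) * R * (1 - P) * ξ).trace ≥
      (4 * (⨅ i, hYY.eigenvalues i) * (⨅ i, hA.1.eigenvalues i) *
          (⨅ i, hM.1.eigenvalues i) - 2 * 𝓡) * (ξᵀ * ξ).trace := by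
    intro S Z ξ hS hZ hξ
    have hF₂ := two_mul_iInf_eigenvalues_mul_trace_le_of_horizontal hYY hS hZ hξ
    have hF : (Y * ξᵀ + ξ * Yᵀ).IsSymm := by
      simp only [IsSymm, transpose_add, transpose_mul, transpose_transpose]
      rw [add_comm]
    generalize Y * ξᵀ + ξ * Yᵀ = F at hF hF₂ ⊢
    have hAM : 0 ≤ (⨅ i, hA.1.eigenvalues i) * (⨅ i, hM.1.eigenvalues i) :=
      mul_nonneg (Real.iInf_nonneg fun i => (hA.eigenvalues_pos i).le)
        (Real.iInf_nonneg fun i => (hM.eigenvalues_pos i).le)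
    have hFAFM := (mul_le_mul_of_nonneg_left hF₂ hAM).trans
      (hA.iInf_eigenvalues_mul_iInf_eigenvalues_mul_trace_le hM hF)
    have hsplit : (F * (A * F * M + M * F * A)).trace = 2 * (F * A * F * M).trace := by
      have h : (F * (M * F * A)).trace = (F * (A * F * M)).trace := by
        rw [← trace_transpose (F * (M * F * A)), trace_mul_comm F (A * F * M)]
        simp only [transpose_mul, hF.eq, hAt, hMt, Matrix.mul_assoc]
      rw [mul_add, trace_add, h]
      simp only [Matrix.mul_assoc]
      ring
    have hcurv : ξᵀ * (1 - P) * R * (1 - P) * ξ = ξᵀ * R * ξ := by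
      calc _ = ξᵀ * ((1 - P) * R * (1 - P)) * ξ := by simp only [Matrix.mul_assoc]
        _ = _ := by rw [hproj]
    have hR_le := (abs_le.1 (abs_trace_transpose_mul_mul_le R ξ)).1
    rw [← h𝓡] at hR_le
    rw [hsplit, hcurv]
    linarith
  refine ⟨hproj, hbound, fun hgap S Z ξ hS hZ hξ hne => ?_⟩
  have hpos : 0 < (ξᵀ * ξ).trace := by
    refine (trace_transpose_mul_self_nonneg ξ).lt_of_ne' fun h => hne ?_
    exact trace_conjTranspose_mul_self_eq_zero_iff.1 (by simpa using h)
  exact (mul_pos (by linarith) hpos).trans_le (hbound S Z ξ hS hZ hξ)
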